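/- Let 𝔄 be a unital complex Banach algebra and let A, B ∈ 𝔄 be invertible with the spectrum of A·B⁻¹ disjoint from ℝ. Then the elements B·A⁻¹, A⁻¹·B and B⁻¹·A also have spectrum disjoint from ℝ, and the following identities hold: pol(A·B⁻¹)·B = −pol(B·A⁻¹)·B = −B·pol(A⁻¹·B) = B·pol(B⁻¹·A). -/

import Mathlib

/-- The polarization `pol H := (1/(2π)) ∫₀^{2π} ((−sin t)·1 + (cos t)·H)·((cos t)·1 + (sin t)·H)⁻¹ dt`
in a unital complex Banach algebra. -/
noncomputable def pol {𝔄 : Type*} [NormedRing 𝔄] [NormedAlgebra ℂ 𝔄] [CompleteSpace 𝔄]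
    (H : 𝔄) : 𝔄 :=
  (2 * Real.pi)⁻¹ • ∫ t in (0:ℝ)..(2 * Real.pi),
    ((-Real.sin t) • (1 : 𝔄) + (Real.cos t) • H) *
      Ring.inverse ((Real.cos t) • (1 : 𝔄) + (Real.sin t) • H)

section PolarizationLemmas

variable {𝔄 : Type*} [NormedRing 𝔄] [NormedAlgebra ℂ 𝔄]

/-- The integrand of the polarization. -/
noncomputable def polIntegrand (H : 𝔄) (t : ℝ) : 𝔄 :=
  ((-Real.sin t) • (1 : 𝔄) + (Real.cos t) • H) *
    Ring.inverse ((Real.cos t) • (1 : 𝔄) + (Real.sin t) • H)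

theorem polIntegrand_periodic (H : 𝔄) : Function.Periodic (polIntegrand H) (2 * Real.pi) := by
  intro t
  simp only [polIntegrand, Real.sin_add_two_pi, Real.cos_add_two_pi]

theorem polIntegrand_units_inv (H : 𝔄ˣ) (t : ℝ) :
    polIntegrand (↑H⁻¹ : 𝔄) t = -polIntegrand (H : 𝔄) (Real.pi / 2 - t) := by
  have num : (-Real.sin t) • (1 : 𝔄) + Real.cos t • (↑H⁻¹ : 𝔄)
      = (Real.cos t • (1 : 𝔄) + (-Real.sin t) • (H : 𝔄)) * ↑H⁻¹ := by
    simp [add_mul, add_comm]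
  have den : Real.cos t • (1 : 𝔄) + Real.sin t • (↑H⁻¹ : 𝔄)
      = (Real.sin t • (1 : 𝔄) + Real.cos t • (H : 𝔄)) * ↑H⁻¹ := by
    simp [add_mul, add_comm]
  simp only [polIntegrand, Real.sin_pi_div_two_sub, Real.cos_pi_div_two_sub]
  rw [num, den, Ring.inverse_mul (Or.inr (Units.isUnit _)), Ring.inverse_unit, inv_inv,
    mul_assoc, Units.inv_mul_cancel_left, ← neg_mul, neg_add, neg_smul, neg_smul, neg_neg]

theorem polIntegrand_units_conj (u : 𝔄ˣ) (H : 𝔄) (t : ℝ) :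
    polIntegrand (↑u⁻¹ * H * u) t = ↑u⁻¹ * polIntegrand H t * u := by
  have key (a b : ℝ) : a • (1 : 𝔄) + b • (↑u⁻¹ * H * u) = ↑u⁻¹ * (a • (1 : 𝔄) + b • H) * u := by
    simp [mul_add, add_mul]
  simp only [polIntegrand]
  rw [key, key, Ring.inverse_mul (Or.inr (Units.isUnit _)), Ring.inverse_unit,
    Ring.inverse_mul (Or.inl (Units.isUnit _)), Ring.inverse_unit, inv_inv]
  simp [mul_assoc]

theorem spectrum_units_inv_im_ne_zero (H : 𝔄ˣ) (h : ∀ z ∈ spectrum ℂ (H : 𝔄), z.im ≠ 0) :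
    ∀ z ∈ spectrum ℂ (↑H⁻¹ : 𝔄), z.im ≠ 0 := by
  intro z hz
  have := h z⁻¹ (spectrum.inv₀_mem_iff.mpr hz)
  contrapose! this
  simp [Complex.inv_im, this]

variable [CompleteSpace 𝔄]

theorem pol_units_inv (H : 𝔄ˣ) : pol (↑H⁻¹ : 𝔄) = -pol (H : 𝔄) := by
  change (2 * Real.pi)⁻¹ • (∫ t in (0:ℝ)..(2 * Real.pi), polIntegrand (↑H⁻¹ : 𝔄) t)
    = -((2 * Real.pi)⁻¹ • ∫ t in (0:ℝ)..(2 * Real.pi), polIntegrand (H : 𝔄) t)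
  simp only [polIntegrand_units_inv]
  rw [intervalIntegral.integral_neg, smul_neg, intervalIntegral.integral_comp_sub_left]
  have := (polIntegrand_periodic (H : 𝔄)).intervalIntegral_add_eq (Real.pi / 2 - 2 * Real.pi) 0
  rw [sub_add_cancel, zero_add] at this
  rw [sub_zero, this]

theorem pol_units_conj (u : 𝔄ˣ) (H : 𝔄) : pol (↑u⁻¹ * H * u) = ↑u⁻¹ * pol H * u := by
  let e : 𝔄 ≃L[ℝ] 𝔄 := ContinuousLinearEquiv.equivOfInverse
    (ContinuousLinearMap.mulLeftRight ℝ 𝔄 ↑u⁻¹ ↑u) (ContinuousLinearMap.mulLeftRight ℝ 𝔄 ↑u ↑u⁻¹)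
    (fun x => by simp [mul_assoc]) (fun x => by simp [mul_assoc])
  have he (x : 𝔄) : e x = ↑u⁻¹ * x * u := rfl
  change (2 * Real.pi)⁻¹ • (∫ t in (0:ℝ)..(2 * Real.pi), polIntegrand (↑u⁻¹ * H * u) t)
    = ↑u⁻¹ * ((2 * Real.pi)⁻¹ • ∫ t in (0:ℝ)..(2 * Real.pi), polIntegrand H t) * u
  simp only [polIntegrand_units_conj]
  simp only [← he, map_smul]
  simp only [intervalIntegral, map_sub, e.integral_comp_comm]

end PolarizationLemmas

theorem stmt9 {𝔄 : Type*} [NormedRing 𝔄] [NormedAlgebra ℂ 𝔄] [CompleteSpace 𝔄]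
    (A B : 𝔄) (hA : IsUnit A) (hB : IsUnit B)
    (h : ∀ z ∈ spectrum ℂ (A * Ring.inverse B), z.im ≠ 0) :
    (∀ z ∈ spectrum ℂ (B * Ring.inverse A), z.im ≠ 0) ∧
    (∀ z ∈ spectrum ℂ (Ring.inverse A * B), z.im ≠ 0) ∧
    (∀ z ∈ spectrum ℂ (Ring.inverse B * A), z.im ≠ 0) ∧
    pol (A * Ring.inverse B) * B = -(pol (B * Ring.inverse A) * B) ∧
    pol (A * Ring.inverse B) * B = -(B * pol (Ring.inverse A * B)) ∧
    pol (A * Ring.inverse B) * B = B * pol (Ring.inverse B * A) := by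
  obtain ⟨a, rfl⟩ := hA
  obtain ⟨b, rfl⟩ := hB
  simp only [Ring.inverse_unit] at h ⊢
  have hinv : (b * ↑a⁻¹ : 𝔄) = ↑(a * b⁻¹)⁻¹ := by simp
  have hinv' : (↑a⁻¹ * b : 𝔄) = ↑(b⁻¹ * a)⁻¹ := by simp
  have hconj : (↑b⁻¹ * a : 𝔄) = ↑b⁻¹ * (a * ↑b⁻¹) * b := by simp [mul_assoc]
  have hspec : ∀ z ∈ spectrum ℂ (↑b⁻¹ * a : 𝔄), z.im ≠ 0 := by
    rwa [hconj, spectrum.units_conjugate']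
  have hpol : pol (a * ↑b⁻¹ : 𝔄) * b = b * pol (↑b⁻¹ * a : 𝔄) := by
    rw [hconj, pol_units_conj, mul_assoc, Units.mul_inv_cancel_left]
  refine ⟨?_, ?_, hspec, ?_, ?_, hpol⟩
  · rw [hinv]
    exact spectrum_units_inv_im_ne_zero _ (by simpa using h)
  · rw [hinv']
    exact spectrum_units_inv_im_ne_zero _ (by simpa using hspec)
  · rw [hinv, pol_units_inv, neg_mul, neg_neg, Units.val_mul]
  · rw [hinv', pol_units_inv, mul_neg, neg_neg, Units.val_mul, hpol]
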